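/- Let K ≥ 1 and let z = (z_1, …, z_K) be a random vector whose coordinates are independent standard Gaussian random variables (i.e. z ~ N(0, I_K)). For any probability vector (p_1, …, p_K) with p_k > 0 for every k and ∑_{k=1}^K p_k = 1, there exists a unique vector μ = (μ_1, …, μ_K) ∈ ℝ^K with μ_1 = 0 such that P[argmax_{1≤l≤K}(z_l + μ_l) = k] = p_k for every k = 1, …, K. -/

import Mathlib

open MeasureTheory ProbabilityTheory

/-- The law of `K` independent standard Gaussian random variables, `N(0, I_K)`. -/
noncomputable def stdGaussianPi (K : ℕ) : Measure (Fin K → ℝ) :=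
  Measure.pi fun _ => gaussianReal 0 1

/-- The event `{z : argmax(z + μ) = k}`, i.e. the maximum of the entries of `z + μ`
is attained (strictly) at the index `k`. -/
def argmaxEvent {K : ℕ} (μ : Fin K → ℝ) (k : Fin K) : Set (Fin K → ℝ) :=
  {z | ∀ j, j ≠ k → z j + μ j < z k + μ k}

open Filter Topology

instance (K : ℕ) : IsProbabilityMeasure (stdGaussianPi K) := by
  unfold stdGaussianPi
  infer_instance

instance (K : ℕ) : (stdGaussianPi K).IsOpenPosMeasure := by
  have : (gaussianReal 0 1).IsOpenPosMeasure :=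
    (gaussianReal_absolutelyContinuous' 0 one_ne_zero).isOpenPosMeasure
  unfold stdGaussianPi
  infer_instance

section ArgmaxEvent

variable {K : ℕ}

lemma isOpen_argmaxEvent (μ : Fin K → ℝ) (k : Fin K) : IsOpen (argmaxEvent μ k) := by
  simp only [argmaxEvent, Set.ofPred_forall]
  exact isOpen_iInter_of_finite fun j => isOpen_iInter_of_finite fun _ =>
    isOpen_lt (by fun_prop) (by fun_prop)

lemma measurableSet_argmaxEvent (μ : Fin K → ℝ) (k : Fin K) :
    MeasurableSet (argmaxEvent μ k) :=
  (isOpen_argmaxEvent μ k).measurableSet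

lemma argmaxEvent_subset_argmaxEvent {μ ν : Fin K → ℝ} {k : Fin K}
    (h : ∀ j, ν j - ν k ≤ μ j - μ k) : argmaxEvent μ k ⊆ argmaxEvent ν k := by
  intro z hz j hj
  linarith [hz j hj, h j]

lemma ae_add_ne_add {j k : Fin K} (hjk : j ≠ k) (a b : ℝ) :
    ∀ᵐ z ∂stdGaussianPi K, z j + a ≠ z k + b := by
  have hind : IndepFun (fun z : Fin K → ℝ => z j) (fun z => z k) (stdGaussianPi K) :=
    (iIndepFun_pi (μ := fun _ : Fin K => gaussianReal 0 1) (X := fun _ => id)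
      (fun _ => aemeasurable_id)).indepFun hjk
  have hmap := (indepFun_iff_map_prod_eq_prod_map_map
    (measurable_pi_apply j).aemeasurable (measurable_pi_apply k).aemeasurable).1 hind
  have hev (i : Fin K) : (stdGaussianPi K).map (fun z => z i) = gaussianReal 0 1 :=
    (measurePreserving_eval (fun _ : Fin K => gaussianReal 0 1) i).map_eq
  rw [hev, hev] at hmap
  have := nullSingletonClass_gaussianReal (μ := 0) (v := 1) one_ne_zero
  have hS : MeasurableSet {x : ℝ × ℝ | x.1 + a = x.2 + b} :=
    measurableSet_eq_fun (by fun_prop) (by fun_prop)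
  have hnull : (gaussianReal 0 1).prod (gaussianReal 0 1) {x : ℝ × ℝ | x.1 + a = x.2 + b} = 0 := by
    rw [Measure.measure_prod_null hS]
    refine ae_of_all _ fun x => ?_
    have : Prod.mk x ⁻¹' {x : ℝ × ℝ | x.1 + a = x.2 + b} = {x + a - b} := by
      ext y
      simp only [Set.mem_preimage, Set.mem_ofPred_eq, Set.mem_singleton_iff]
      constructor <;> intro h <;> linarith
    simp [this]
  rw [← hmap, Measure.map_apply (by fun_prop) hS] at hnull
  rw [ae_iff]
  simpa using hnull

lemma ae_pairwise_add_ne_add (μ : Fin K → ℝ) :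
    ∀ᵐ z ∂stdGaussianPi K, ∀ j k, j ≠ k → z j + μ j ≠ z k + μ k := by
  simp only [ae_all_iff]
  exact fun j k hjk => ae_add_ne_add hjk _ _

lemma sum_measureReal_argmaxEvent [Nonempty (Fin K)] (μ : Fin K → ℝ) :
    ∑ k, (stdGaussianPi K).real (argmaxEvent μ k) = 1 := by
  rw [← measureReal_biUnion_finset _ fun k _ => measurableSet_argmaxEvent μ k]
  · rw [← probReal_univ (μ := stdGaussianPi K)]
    refine measureReal_congr ?_
    filter_upwards [ae_pairwise_add_ne_add μ] with z hz
    obtain ⟨k, hk⟩ := Finite.exists_max fun j => z j + μ j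
    refine propext ⟨fun _ => trivial, fun _ => ?_⟩
    exact Set.mem_biUnion (Finset.mem_univ k) fun j hj => lt_of_le_of_ne (hk j) (hz j k hj)
  · intro j _ k _ hjk
    refine Set.disjoint_left.2 fun z hj hk => ?_
    exact lt_asymm (hj k hjk.symm) (hk j hjk)

lemma continuous_measureReal_argmaxEvent (k : Fin K) :
    Continuous fun μ : Fin K → ℝ => (stdGaussianPi K).real (argmaxEvent μ k) := by
  refine continuous_iff_continuousAt.2 fun μ => ?_
  refine (ENNReal.tendsto_toReal (measure_ne_top _ _)).comp ?_
  refine tendsto_measure_of_ae_tendsto_indicator_of_isFiniteMeasure _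
    (measurableSet_argmaxEvent μ k) (fun ν => measurableSet_argmaxEvent ν k) ?_
  filter_upwards [ae_pairwise_add_ne_add μ] with z hz
  have key : ∀ j, ∀ᶠ ν : Fin K → ℝ in 𝓝 μ,
      (j ≠ k → z j + ν j < z k + ν k) ↔ (j ≠ k → z j + μ j < z k + μ k) := by
    intro j
    rcases eq_or_ne j k with rfl | hj
    · simp
    have hcont (i : Fin K) : Continuous fun ν : Fin K → ℝ => z i + ν i := by fun_prop
    rcases lt_or_gt_of_ne (hz j k hj) with h | h
    · filter_upwards [(hcont j).continuousAt.eventually_lt (hcont k).continuousAt h] with ν hν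
      simp [h, hν]
    · filter_upwards [(hcont k).continuousAt.eventually_lt (hcont j).continuousAt h] with ν hν
      simp [not_lt_of_gt h, not_lt_of_gt hν, hj]
  filter_upwards [eventually_all.2 key] with ν hν
  exact forall_congr' hν

lemma eventually_measureReal_add_lt {ε : ℝ} (hε : 0 < ε) (j k : Fin K) :
    ∀ᶠ M : ℝ in atTop, (stdGaussianPi K).real {z | z j + M < z k} < ε := by
  have h := tendsto_measure_iInter_atTop (μ := stdGaussianPi K)
    (s := fun M : ℝ => {z : Fin K → ℝ | z j + M < z k})
    (fun M => (measurableSet_lt (by fun_prop) (by fun_prop)).nullMeasurableSet)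
    (fun M N hMN z hz => by
      simp only [Set.mem_ofPred_eq] at hz ⊢
      linarith)
    ⟨0, measure_ne_top _ _⟩
  have hempty : ⋂ M : ℝ, {z : Fin K → ℝ | z j + M < z k} = ∅ := by
    refine Set.eq_empty_of_forall_notMem fun z hz => ?_
    have := Set.mem_iInter.1 hz (z k - z j)
    simp at this
  rw [hempty, measure_empty] at h
  have h' := (ENNReal.tendsto_toReal ENNReal.zero_ne_top).comp h
  exact h'.eventually_lt_const (by simpa using hε)

lemma measureReal_argmaxEvent_lt {μ ν : Fin K → ℝ} {j k : Fin K}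
    (h : ∀ l, ν l - ν k ≤ μ l - μ k) (hj : ν j - ν k < μ j - μ k) :
    (stdGaussianPi K).real (argmaxEvent μ k) < (stdGaussianPi K).real (argmaxEvent ν k) := by
  have hjk : j ≠ k := by
    rintro rfl
    linarith
  let U : Set (Fin K → ℝ) := argmaxEvent ν k ∩ {z | z k + μ k < z j + μ j}
  have hU : IsOpen U :=
    (isOpen_argmaxEvent ν k).inter (isOpen_lt (by fun_prop) (by fun_prop))
  have hne : U.Nonempty := by
    obtain ⟨c, hc₁, hc₂⟩ := exists_between hj
    refine ⟨fun l => if l = k then 0 else if l = j then -c else ν k - ν l - 1, ?_, ?_⟩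
    · intro l hl
      by_cases hlj : l = j
      · subst hlj
        simp only [hl, if_true, if_false]
        linarith
      · simp only [hl, hlj, if_true, if_false]
        linarith
    · simp only [Set.mem_ofPred_eq, hjk, if_true, if_false]
      linarith
  have hpos : 0 < (stdGaussianPi K).real U :=
    ENNReal.toReal_pos (hU.measure_pos _ hne).ne' (measure_ne_top _ _)
  have hdisj : Disjoint (argmaxEvent μ k) U :=
    Set.disjoint_left.2 fun z hz hzU => lt_asymm (hz j hjk) hzU.2
  calc (stdGaussianPi K).real (argmaxEvent μ k)
      < (stdGaussianPi K).real (argmaxEvent μ k) + (stdGaussianPi K).real U := by linarith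
    _ = (stdGaussianPi K).real (argmaxEvent μ k ∪ U) :=
      (measureReal_union hdisj hU.measurableSet).symm
    _ ≤ _ := measureReal_mono
      (Set.union_subset (argmaxEvent_subset_argmaxEvent h) Set.inter_subset_left)

lemma eq_of_measureReal_argmaxEvent_eq {μ ν : Fin K → ℝ} {i : Fin K} (hi : μ i = ν i)
    (h : ∀ k, (stdGaussianPi K).real (argmaxEvent μ k) =
      (stdGaussianPi K).real (argmaxEvent ν k)) : μ = ν := by
  have : Nonempty (Fin K) := ⟨i⟩
  obtain ⟨k, hk⟩ := Finite.exists_max fun j => μ j - ν j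
  have hconst : ∀ j, μ j - ν j = μ k - ν k := by
    intro j
    by_contra hne
    have hlt := lt_of_le_of_ne (hk j) hne
    refine (measureReal_argmaxEvent_lt (μ := ν) (ν := μ) (j := j) (k := k)
      (fun l => ?_) ?_).ne' (h k)
    · linarith [hk l]
    · linarith
  funext j
  linarith [hconst j, hconst i]

lemma exists_measureReal_argmaxEvent_eq (i : Fin K) {p : Fin K → ℝ} (hp : ∀ k, 0 < p k)
    (hsum : ∑ k, p k = 1) :
    ∃ μ : Fin K → ℝ, μ i = 0 ∧ ∀ k, (stdGaussianPi K).real (argmaxEvent μ k) = p k := by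
  have : Nonempty (Fin K) := ⟨i⟩
  obtain ⟨M, hM, hM₀⟩ := ((eventually_all.2 fun j => eventually_all.2 fun k =>
    eventually_measureReal_add_lt (hp k) j k).and (eventually_ge_atTop 0)).exists
  let q : (Fin K → ℝ) → Fin K → ℝ := fun μ k => (stdGaussianPi K).real (argmaxEvent μ k)
  have hq (k : Fin K) : Continuous fun μ => q μ k := continuous_measureReal_argmaxEvent k
  let A : Set (Fin K → ℝ) :=
    Set.Icc (fun _ => -M) (fun _ => M) ∩ ({μ | μ i = 0} ∩ {μ | ∀ k, k ≠ i → q μ k ≤ p k})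
  have hA : IsCompact A := by
    refine isCompact_Icc.inter_right
      ((isClosed_eq (by fun_prop) (by fun_prop)).inter ?_)
    simp only [Set.ofPred_forall]
    exact isClosed_iInter fun k => isClosed_iInter fun _ => isClosed_le (hq k) continuous_const
  have hne : A.Nonempty := by
    refine ⟨fun k => if k = i then 0 else -M, ⟨fun k => ?_, fun k => ?_⟩, by simp, ?_⟩
    · dsimp only
      split_ifs <;> linarith
    · dsimp only
      split_ifs <;> linarith
    · intro k hk
      refine (measureReal_mono fun z hz => ?_).trans (hM i k).le
      have := hz i hk.symm
      simp only [hk, if_true, if_false] at this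
      simp only [Set.mem_ofPred_eq]
      linarith
  obtain ⟨μ, ⟨hbox, hμi, hμp⟩, hmax⟩ := hA.exists_isMaxOn hne
    (f := fun μ : Fin K → ℝ => ∑ k, μ k) (by fun_prop)
  simp only [Set.mem_ofPred_eq] at hμi hμp
  have hsplit (f : Fin K → ℝ) : ∑ k, f k = f i + ∑ k ∈ Finset.univ.erase i, f k :=
    (Finset.add_sum_erase _ f (Finset.mem_univ i)).symm
  have hq₁ : ∑ k, q μ k = 1 := sum_measureReal_argmaxEvent μ
  rw [hsplit] at hq₁ hsum
  have hpi : p i ≤ q μ i := by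
    have : ∑ k ∈ Finset.univ.erase i, q μ k ≤ ∑ k ∈ Finset.univ.erase i, p k :=
      Finset.sum_le_sum fun k hk => hμp k (Finset.ne_of_mem_erase hk)
    linarith
  have hltM (k : Fin K) (hk : k ≠ i) : μ k < M := by
    by_contra! hMk
    refine (hM k i).not_ge (hpi.trans (measureReal_mono fun z hz => ?_))
    have := hz k hk
    simp only [Set.mem_ofPred_eq]
    linarith
  have heq (k : Fin K) (hk : k ≠ i) : q μ k = p k := by
    by_contra hkp
    have hlt : q μ k < p k := lt_of_le_of_ne (hμp k hk) hkp
    have hupd : Tendsto (fun x : ℝ => Function.update μ k x) (𝓝[>] (μ k)) (𝓝 μ) := by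
      have hc : Continuous fun x : ℝ => Function.update μ k x := by fun_prop
      have := hc.tendsto (μ k)
      rw [Function.update_eq_self] at this
      exact this.mono_left nhdsWithin_le_nhds
    have h₁ := (((hq k).tendsto μ).comp hupd).eventually_lt_const hlt
    have h₂ : ∀ᶠ x in 𝓝[>] (μ k), x < M :=
      nhdsWithin_le_nhds (eventually_lt_nhds (hltM k hk))
    obtain ⟨x, ⟨hx₁, hx₂⟩, hx₃⟩ := ((h₁.and h₂).and self_mem_nhdsWithin).exists
    simp only [Function.comp_apply] at hx₁ hx₃
    have hmem : Function.update μ k x ∈ A := by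
      refine ⟨⟨fun j => ?_, fun j => ?_⟩, ?_, fun j hj => ?_⟩
      · rcases eq_or_ne j k with rfl | hjk
        · simpa using (hbox.1 j).trans hx₃.le
        · simpa [hjk] using hbox.1 j
      · rcases eq_or_ne j k with rfl | hjk
        · simpa using hx₂.le
        · simpa [hjk] using hbox.2 j
      · simpa [hk.symm] using hμi
      · rcases eq_or_ne j k with rfl | hjk
        · exact hx₁.le
        · refine (measureReal_mono (argmaxEvent_subset_argmaxEvent fun l => ?_)).trans (hμp j hj)
          rcases eq_or_ne l k with rfl | hlk
          · simpa [hjk] using hx₃.le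
          · simp [hjk, hlk]
    have hle : ∑ j, Function.update μ k x j ≤ ∑ j, μ j := hmax hmem
    refine hle.not_gt (Finset.sum_lt_sum (fun j _ => ?_) ⟨k, Finset.mem_univ k, by simpa using hx₃⟩)
    rcases eq_or_ne j k with rfl | hjk
    · simpa using hx₃.le
    · simp [hjk]
  refine ⟨μ, hμi, fun k => ?_⟩
  rcases eq_or_ne k i with rfl | hk
  · have : ∑ j ∈ Finset.univ.erase k, q μ j = ∑ j ∈ Finset.univ.erase k, p j :=
      Finset.sum_congr rfl fun j hj => heq j (Finset.ne_of_mem_erase hj)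
    change q μ k = p k
    linarith
  · exact heq k hk

end ArgmaxEvent

/-- **Existence and Uniqueness** (Theorem 1): for any categorical distribution
`(p_1, …, p_K)` with all `p_k > 0` summing to `1`, there is a unique `μ ∈ ℝ^K`
with `μ_1 = 0` such that `P[argmax(z + μ) = k] = p_k` for all `k`,
where `z ~ N(0, I_K)`. -/
theorem gaussianMax_exists_unique_mu (K : ℕ) (hK : 1 ≤ K)
    (p : Fin K → ℝ) (hp : ∀ k, 0 < p k) (hsum : ∑ k, p k = 1) :
    ∃! μ : Fin K → ℝ, μ ⟨0, hK⟩ = 0 ∧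
      ∀ k, stdGaussianPi K (argmaxEvent μ k) = ENNReal.ofReal (p k) := by
  have hiff (μ : Fin K → ℝ) (k : Fin K) :
      stdGaussianPi K (argmaxEvent μ k) = ENNReal.ofReal (p k) ↔
        (stdGaussianPi K).real (argmaxEvent μ k) = p k := by
    rw [← ofReal_measureReal, ENNReal.ofReal_eq_ofReal_iff measureReal_nonneg (hp k).le]
  simp only [hiff]
  obtain ⟨μ, hμ₀, hμ⟩ := exists_measureReal_argmaxEvent_eq ⟨0, hK⟩ hp hsum
  refine ⟨μ, ⟨hμ₀, hμ⟩, fun ν hν => ?_⟩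
  exact eq_of_measureReal_argmaxEvent_eq (hν.1.trans hμ₀.symm)
    fun k => (hν.2 k).trans (hμ k).symm
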